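/- Let Δ: v_1, F_1, v_2, F_2, …, v_{2s+1}, F_{2s+1}, v_{2s+2} = v_1 be a special odd cycle with s ≥ 1 and I = I(Δ) its facet ideal. Then the prime ideal P = (x_{v_1},…,x_{v_{2s+1}}) is an associated prime of I^m for every m ≥ s+1; indeed, for m ≥ s+1 one has I^m : (u · (∏_{j ∈ F_1} x_j)^{m−s−1}) = P, where u = ∏_{i=1}^{2s+1} ( x_{v_i} · ∏_{j ∈ F_i ∖ {v_i, v_{i+1}}} x_j ). -/

import Mathlib

open MvPolynomial

/-- The substitution sending the variables in `V` to `0` and fixing the others. -/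
noncomputable def killVars {σ : Type*} (K : Type*) [CommRing K] (V : Set σ) :
    MvPolynomial σ K →ₐ[K] MvPolynomial σ K :=
  open Classical in aeval fun j => if j ∈ V then 0 else X j

/-- The substitution sending the variables in `V` to the polynomial variable and fixing
the others. -/
noncomputable def markVars {σ : Type*} (K : Type*) [CommRing K] (V : Set σ) :
    MvPolynomial σ K →ₐ[K] Polynomial (MvPolynomial σ K) :=
  open Classical in aeval fun j => if j ∈ V then Polynomial.X else Polynomial.C (X j)

section Substitution

variable {σ K : Type*} [CommRing K] {V : Set σ}

lemma markVars_X_of_mem {j : σ} (hj : j ∈ V) :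
    markVars K V (X j) = Polynomial.X := by
  simp [markVars, hj]

lemma markVars_X_of_notMem {j : σ} (hj : j ∉ V) :
    markVars K V (X j) = Polynomial.C (X j) := by
  simp [markVars, hj]

lemma markVars_prod_X_of_disjoint {S : Finset σ} (hS : ∀ j ∈ S, j ∉ V) :
    markVars K V (∏ j ∈ S, X j) = Polynomial.C (∏ j ∈ S, X j) := by
  rw [map_prod, map_prod]
  exact Finset.prod_congr rfl fun j hj => markVars_X_of_notMem (hS j hj)

lemma coeff_zero_markVars (p : MvPolynomial σ K) :
    (markVars K V p).coeff 0 = killVars K V p := by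
  have h : ((Polynomial.aeval (0 : MvPolynomial σ K)).restrictScalars K).comp
      (markVars K V) = killVars K V := by
    refine MvPolynomial.algHom_ext fun j => ?_
    by_cases hj : j ∈ V <;> simp [markVars, killVars, hj]
  rw [← h, Polynomial.coeff_zero_eq_aeval_zero]
  rfl

lemma ker_killVars : RingHom.ker (killVars K V) = Ideal.span (X '' V) := by
  apply le_antisymm
  · intro p hp
    have h : (Ideal.Quotient.mkₐ K (Ideal.span (X '' V : Set (MvPolynomial σ K)))).comp
        (killVars K V) = Ideal.Quotient.mkₐ K _ := by
      refine MvPolynomial.algHom_ext fun j => ?_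
      by_cases hj : j ∈ V
      · have : (X j : MvPolynomial σ K) ∈ Ideal.span (X '' V : Set (MvPolynomial σ K)) :=
          Ideal.subset_span ⟨j, hj, rfl⟩
        simpa [killVars, hj] using (Ideal.Quotient.eq_zero_iff_mem.mpr this).symm
      · simp [killVars, hj]
    rw [← Ideal.Quotient.eq_zero_iff_mem, ← Ideal.Quotient.mkₐ_eq_mk K, ← h]
    simp [(RingHom.mem_ker).mp hp]
  · rw [Ideal.span_le]
    rintro _ ⟨j, hj, rfl⟩
    simp [killVars, RingHom.mem_ker, hj]

end Substitution

/-- If every generator of `I` is divisible by `T ^ 2` after marking the variables in `V`, while `w`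
is marked to `T ^ (2 * m - 1)` times a nonzero constant, then `I ^ m : w` is contained in the
ideal of the variables in `V`. -/
lemma mem_span_of_mul_mem_pow {σ K : Type*} [Field K] {V : Set σ}
    {I : Ideal (MvPolynomial σ K)}
    (hI : I ≤ (Ideal.span {Polynomial.X ^ 2}).comap (markVars K V))
    {w c : MvPolynomial σ K} {m : ℕ} (hm : 1 ≤ m) (hc : c ≠ 0)
    (hw : markVars K V w = Polynomial.X ^ (2 * m - 1) * Polynomial.C c)
    {h : MvPolynomial σ K} (hh : h * w ∈ I ^ m) : h ∈ Ideal.span (X '' V) := by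
  have h1 : markVars K V (h * w) ∈
      (Ideal.span {(Polynomial.X : Polynomial (MvPolynomial σ K)) ^ 2}) ^ m :=
    (Ideal.pow_right_mono hI m).trans (Ideal.le_comap_pow _ m) hh
  rw [Ideal.span_singleton_pow, Ideal.mem_span_singleton, map_mul, hw, ← pow_mul,
    show 2 * m = 2 * m - 1 + 1 by omega, pow_succ, Nat.add_sub_cancel, mul_left_comm] at h1
  have h2 := (Polynomial.X_dvd_iff).mp
    ((mul_dvd_mul_iff_left (pow_ne_zero _ Polynomial.X_ne_zero)).mp h1)
  rw [Polynomial.coeff_mul_C, coeff_zero_markVars] at h2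
  rw [← ker_killVars]
  exact (mul_eq_zero.mp h2).resolve_right hc

lemma prod_range_mul_prod_range_alternating {M : Type*} [CommMonoid M] (a b : ℕ → M) (t : ℕ) :
    (∏ i ∈ Finset.range (2 * t + 2), a i) * ∏ i ∈ Finset.range (2 * t + 1), b i =
      (∏ i ∈ Finset.range (t + 1), a (2 * i) * a (2 * i + 1) * b (2 * i)) *
        ∏ i ∈ Finset.range t, b (2 * i + 1) := by
  induction t with
  | zero => simp [Finset.prod_range_succ]
  | succ t ih =>
    rw [show 2 * (t + 1) + 2 = 2 * t + 2 + 1 + 1 by ring,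
      show 2 * (t + 1) + 1 = 2 * t + 1 + 1 + 1 by ring,
      Finset.prod_range_succ a (2 * t + 2 + 1), Finset.prod_range_succ a (2 * t + 2),
      Finset.prod_range_succ b (2 * t + 1 + 1), Finset.prod_range_succ b (2 * t + 1),
      Finset.prod_range_succ _ (t + 1), Finset.prod_range_succ (fun i => b (2 * i + 1)) t,
      show 2 * (t + 1) + 1 = 2 * t + 2 + 1 by ring, show 2 * (t + 1) = 2 * t + 2 by ring]
    calc _ = ((∏ i ∈ Finset.range (2 * t + 2), a i) * ∏ i ∈ Finset.range (2 * t + 1), b i) *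
          (a (2 * t + 2) * a (2 * t + 2 + 1) * (b (2 * t + 1) * b (2 * t + 2))) := by
            simp only [mul_assoc, mul_left_comm]
      _ = _ := by
            rw [ih]
            simp only [mul_assoc, mul_left_comm, mul_comm]

/-- Going once around an odd cycle from position `k` to itself, and using every other edge, covers
all vertices, with `k` covered twice. -/
lemma mul_prod_mem_pow_of_odd_cycle {R : Type*} [CommRing R] (I : Ideal R) (s : ℕ)
    (x g : Fin (2 * s + 1) → R) (hI : ∀ i, x i * x (i + 1) * g i ∈ I) (k : Fin (2 * s + 1)) :
    x k * ∏ i, (x i * g i) ∈ I ^ (s + 1) := by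
  let r (i : ℕ) : Fin (2 * s + 1) := k + Fin.ofNat (2 * s + 1) i
  have hr_succ (i : ℕ) : r (i + 1) = r i + 1 := by
    simp only [r, add_assoc]
    congr 1
    ext
    simp [Fin.val_add]
  have hr_last : r (2 * s + 1) = k := by
    simp [r]
  have hshift (y : Fin (2 * s + 1) → R) :
      ∏ i, y i = ∏ i ∈ Finset.range (2 * s + 1), y (r i) := by
    rw [← Fin.prod_univ_eq_prod_range (fun i : ℕ => y (r i)), ← Equiv.prod_comp (Equiv.addLeft k)]
    refine Finset.prod_congr rfl fun i _ => ?_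
    simp [r]
  have key := prod_range_mul_prod_range_alternating (fun i => x (r i)) (fun i => g (r i)) s
  rw [Finset.prod_range_succ, hr_last, ← hshift x, ← hshift g] at key
  rw [Finset.prod_mul_distrib, ← mul_assoc, mul_comm (x k), key]
  refine Ideal.mul_mem_right _ _ ?_
  have := Ideal.prod_mem_prod (s := Finset.range (s + 1)) (I := fun _ => I)
    (x := fun i => x (r (2 * i)) * x (r (2 * i + 1)) * g (r (2 * i)))
    fun i _ => hr_succ (2 * i) ▸ hI (r (2 * i))
  simpa only [Finset.prod_const, Finset.card_range] using this

lemma ideal_mem_associatedPrimes_quotient_of_colon_eq {R : Type*} [CommRing R] {J P : Ideal R}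
    [hP : P.IsPrime] {w : R} (h : J.colon (Ideal.span {w}) = P) :
    P ∈ associatedPrimes R (R ⧸ J) := by
  refine ⟨hP, Ideal.Quotient.mk J w, ?_⟩
  have : (⊥ : Submodule R (R ⧸ J)).colon {Ideal.Quotient.mk J w} = P := by
    ext r
    rw [Submodule.mem_colon_singleton, ← h, Ideal.mem_colon_span_singleton, Submodule.mem_bot,
      ← Ideal.Quotient.eq_zero_iff_mem, map_mul]
    rfl
  rw [this, hP.radical]

/-- **Theorem (Step 1).** For a special odd cycle
`Δ : v_1, F_1, …, v_{2s+1}, F_{2s+1}, v_{2s+2} = v_1` with `s ≥ 1` and facet ideal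
`I = I(Δ)`, the prime `P = (x_{v_1},…,x_{v_{2s+1}})` is an associated prime of
`I^m` for every `m ≥ s+1`; indeed
`I^m : (u (∏_{j ∈ F_1} x_j)^{m-s-1}) = P`, where
`u = ∏_{i=1}^{2s+1} ( x_{v_i} ∏_{j ∈ F_i ∖ {v_i,v_{i+1}}} x_j )`. -/
theorem specialOddCycle_ass_large_powers {K : Type*} [Field K] (n s : ℕ) (hs : 1 ≤ s)
    (F : Fin (2 * s + 1) → Finset (Fin n)) (v : Fin (2 * s + 1) → Fin n)
    (hFinj : Function.Injective F)
    (hFcover : ∀ a : Fin n, ∃ i, a ∈ F i)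
    (hFincomp : ∀ i j, i ≠ j → ¬ F i ⊆ F j)
    (hvinj : Function.Injective v)
    (hvF : ∀ i, v i ∈ F i ∧ v (i + 1) ∈ F i)
    (hspecial : ∀ i, (Finset.univ.filter fun j => v j ∈ F i).card ≤ 2)
    (I : Ideal (MvPolynomial (Fin n) K))
    (hI : I = Ideal.span (Set.range fun i => ∏ j ∈ F i, (X j : MvPolynomial (Fin n) K)))
    (P : Ideal (MvPolynomial (Fin n) K))
    (hP : P = Ideal.span (Set.range fun i => (X (v i) : MvPolynomial (Fin n) K)))
    (u : MvPolynomial (Fin n) K)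
    (hu : u = ∏ i : Fin (2 * s + 1),
        ((X (v i) : MvPolynomial (Fin n) K) * ∏ j ∈ F i \ {v i, v (i + 1)}, X j)) :
    ∀ m : ℕ, s + 1 ≤ m →
      P ∈ associatedPrimes (MvPolynomial (Fin n) K)
          (MvPolynomial (Fin n) K ⧸ I ^ m) ∧
      (I ^ m).colon (Ideal.span
          {u * (∏ j ∈ F (⟨0, by omega⟩ : Fin (2 * s + 1)),
              (X j : MvPolynomial (Fin n) K)) ^ (m - s - 1)}) = P := by
  intro m hm
  let g : Fin (2 * s + 1) → MvPolynomial (Fin n) K :=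
    fun i => ∏ j ∈ F i \ {v i, v (i + 1)}, X j
  have hne (i : Fin (2 * s + 1)) : i ≠ i + 1 := by
    intro h
    have h1 : (1 : Fin (2 * s + 1)) = 0 := by simpa using h.symm
    have := congrArg Fin.val h1
    rw [Fin.val_one', Nat.mod_eq_of_lt (by omega)] at this
    simp at this
  have hf (i) : ∏ j ∈ F i, (X j : MvPolynomial (Fin n) K) = X (v i) * X (v (i + 1)) * g i := by
    have hsub : {v i, v (i + 1)} ⊆ F i := by
      simp [Finset.insert_subset_iff, hvF i]
    rw [← Finset.prod_sdiff hsub, Finset.prod_pair (hvinj.ne (hne i)), mul_comm]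
  have hfree (i) : ∀ j ∈ F i \ {v i, v (i + 1)}, j ∉ Set.range v := by
    rintro _ hj ⟨k, rfl⟩
    simp only [Finset.mem_sdiff, Finset.mem_insert, Finset.mem_singleton, not_or] at hj
    have hsub : ({k, i, i + 1} : Finset (Fin (2 * s + 1))) ⊆
        Finset.univ.filter fun j => v j ∈ F i := by
      simp [Finset.insert_subset_iff, hvF i, hj.1]
    have h3 := (Finset.card_le_card hsub).trans (hspecial i)
    rw [Finset.card_eq_three.mpr ⟨k, i, i + 1, fun h => hj.2.1 (h ▸ rfl),
      fun h => hj.2.2 (h ▸ rfl), hne i, rfl⟩] at h3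
    omega
  have hg0 (i) : g i ≠ 0 := Finset.prod_ne_zero_iff.mpr fun j _ => X_ne_zero j
  have hmark (i) : markVars K (Set.range v) (∏ j ∈ F i, X j) =
      Polynomial.X ^ 2 * Polynomial.C (g i) := by
    rw [hf, map_mul, map_mul, markVars_X_of_mem (Set.mem_range_self i),
      markVars_X_of_mem (Set.mem_range_self (i + 1)),
      markVars_prod_X_of_disjoint (hfree i), sq]
  have hmarku : markVars K (Set.range v) u =
      Polynomial.X ^ (2 * s + 1) * Polynomial.C (∏ i, g i) := by
    rw [hu, Finset.prod_mul_distrib, map_mul, map_prod, map_prod, map_prod]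
    congr 1
    · simp [markVars_X_of_mem]
    · exact Finset.prod_congr rfl fun i _ => markVars_prod_X_of_disjoint (hfree i)
  have hPV : P = Ideal.span (X '' Set.range v) := by
    rw [hP, ← Set.range_comp]
    rfl
  have hprime : P.IsPrime := by
    rw [hPV, ← ker_killVars]
    exact RingHom.ker_isPrime _
  have hmem (i) : ∏ j ∈ F i, (X j : MvPolynomial (Fin n) K) ∈ I :=
    hI ▸ Ideal.subset_span ⟨i, rfl⟩
  have hcolon : (I ^ m).colon (Ideal.span
      {u * (∏ j ∈ F (⟨0, by omega⟩ : Fin (2 * s + 1)),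
        (X j : MvPolynomial (Fin n) K)) ^ (m - s - 1)}) = P := by
    apply le_antisymm
    · intro h hh
      rw [Ideal.mem_colon_span_singleton] at hh
      rw [hPV]
      refine mem_span_of_mul_mem_pow (c := (∏ i, g i) * g (⟨0, by omega⟩ : Fin (2 * s + 1)) ^ (m - s - 1)) ?_
        (by omega)
        (mul_ne_zero (Finset.prod_ne_zero_iff.mpr fun i _ => hg0 i) (pow_ne_zero _ (hg0 _))) ?_ hh
      · rw [hI, Ideal.span_le]
        rintro _ ⟨i, rfl⟩
        rw [SetLike.mem_coe, Ideal.mem_comap, hmark, Ideal.mem_span_singleton]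
        exact dvd_mul_right _ _
      · rw [map_mul, map_pow, hmark, hmarku, show 2 * m - 1 = 2 * s + 1 + 2 * (m - s - 1) by omega,
          map_mul, map_pow, mul_pow, pow_add, pow_mul]
        ring
    · rw [hP, Ideal.span_le]
      rintro _ ⟨k, rfl⟩
      rw [SetLike.mem_coe, Ideal.mem_colon_span_singleton, ← mul_assoc,
        show I ^ m = I ^ (s + 1) * I ^ (m - s - 1) by rw [← pow_add]; congr 1; omega, hu]
      exact Ideal.mul_mem_mul
        (mul_prod_mem_pow_of_odd_cycle I s (fun i => X (v i)) g (fun i => hf i ▸ hmem i) k)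
        (Ideal.pow_mem_pow (hmem _) _)
  exact ⟨ideal_mem_associatedPrimes_quotient_of_colon_eq hcolon, hcolon⟩
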